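/- Fix a real number p with 0 < p ≤ 1 and real numbers α₁ ≥ α₂ > 0. For every real δ > 0, the probability that the binomial random graph G(⌈(2α₁+α₂+δ)n⌉, p) arrows (C_{2⌊α₁n⌋}, C_{2⌊α₂n⌋}) tends to 1 as n → ∞. -/

import Mathlib

-- Probability, under the binomial random graph model `G(N,p)`, of a set of graphs
-- on the vertex set `Fin N`: each possible edge is present independently with probability `p`.
open Classical in
noncomputable def graphProbability (N : ℕ) (p : ℝ) (E : Set (SimpleGraph (Fin N))) : ℝ :=
  ∑ G : SimpleGraph (Fin N),
    if G ∈ E then p ^ (Nat.card G.edgeSet) * (1 - p) ^ (N.choose 2 - Nat.card G.edgeSet) else 0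

/-- `F` has a cycle of length `m`, all of whose edges get color `i` under `c`. -/
def HasMonoCycle {V : Type*} (F : SimpleGraph V) {k : ℕ} (c : F.edgeSet → Fin k)
    (i : Fin k) (m : ℕ) : Prop :=
  ∃ (v : V) (w : F.Walk v v), w.IsCycle ∧ w.length = m ∧
    ∀ e (h : e ∈ w.edges), c ⟨e, w.edges_subset_edgeSet h⟩ = i

/-- `F → (C_{n 0}, …, C_{n (k-1)})`: every `k`-coloring of the edges of `F` yields,
for some color `i`, a cycle on `n i` vertices all of whose edges have color `i`. -/
def ArrowsCycles {V : Type*} (F : SimpleGraph V) {k : ℕ} (n : Fin k → ℕ) : Prop :=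
  ∀ c : F.edgeSet → Fin k, ∃ i : Fin k, HasMonoCycle F c i (n i)

/-- `G` has a matching with `q` edges, recorded as a list of ordered pairs, all of whose edges lie
in the same connected component of `G`. -/
def HasConnMatching {ι : Type*} (G : SimpleGraph ι) (q : ℕ) : Prop :=
  ∃ M : List (ι × ι), M.length = q ∧ (∀ e ∈ M, G.Adj e.1 e.2) ∧
    (M.flatMap fun e => [e.1, e.2]).Nodup ∧ ∀ e ∈ M, ∀ e' ∈ M, G.Reachable e.1 e'.1

section Matching

open Finset

theorem map_sublist_flatMap {ι : Type*} (f : ι × ι → ι)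
    (hf : ∀ e, f e = e.1 ∨ f e = e.2) (M : List (ι × ι)) :
    (M.map f).Sublist (M.flatMap fun e => [e.1, e.2]) := by
  induction M with
  | nil => simp
  | cons e M ih =>
    simp only [List.map_cons, List.flatMap_cons, List.cons_append, List.nil_append]
    rcases hf e with h | h
    · rw [h]; exact (ih.cons _).cons_cons _
    · rw [h]; exact (ih.cons_cons _).cons _

variable {ι : Type*} [DecidableEq ι]

theorem exists_matching_of_few_nonadj (Q : SimpleGraph ι) [DecidableRel Q.Adj] (f y : ℕ) :
    ∀ W R : Finset ι, Disjoint W R →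
      (∀ u ∈ W ∪ R, #{v ∈ R | ¬ Q.Adj u v} ≤ f) → y + 2 * f ≤ #R → 2 * y + 2 * f ≤ #R + #W →
      ∃ M : List (ι × ι), M.length = y ∧ (∀ e ∈ M, Q.Adj e.1 e.2) ∧
        (M.flatMap fun e => [e.1, e.2]).Nodup ∧ ∀ v ∈ M.flatMap fun e => [e.1, e.2], v ∈ W ∪ R := by
  induction y with
  | zero => intro W R _ _ _ _; exact ⟨[], by simp⟩
  | succ y ih =>
    intro W R hd hf h1 h2
    have key : ∀ u ∈ W ∪ R, ∃ v ∈ R, Q.Adj u v := by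
      intro u hu
      by_contra! hcon
      have := hf u hu
      rw [filter_true_of_mem hcon] at this
      omega
    have step : ∀ u v, u ∈ W ∪ R → v ∈ R → Q.Adj u v →
        y + 2 * f ≤ #((R.erase u).erase v) →
        2 * y + 2 * f ≤ #((R.erase u).erase v) + #(W.erase u) →
        ∃ M : List (ι × ι), M.length = y + 1 ∧ (∀ e ∈ M, Q.Adj e.1 e.2) ∧
        (M.flatMap fun e => [e.1, e.2]).Nodup ∧
          ∀ v ∈ M.flatMap fun e => [e.1, e.2], v ∈ W ∪ R := by
      intro u v hu hv huv h3 h4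
      have hR' : (R.erase u).erase v ⊆ R := (erase_subset _ _).trans (erase_subset _ _)
      obtain ⟨M, hM1, hM2, hM3, hM4⟩ := ih (W.erase u) ((R.erase u).erase v)
        (disjoint_of_subset_left (erase_subset _ _) (disjoint_of_subset_right hR' hd))
        (fun w hw => (card_le_card (filter_subset_filter _ hR')).trans
          (hf w (union_subset_union (erase_subset _ _) hR' hw))) h3 h4
      have hvW : v ∉ W := fun h => disjoint_left.1 hd h hv
      have hu' : u ∉ M.flatMap fun e => [e.1, e.2] := fun h => by
        have := hM4 u h
        simp at this
      have hv' : v ∉ M.flatMap fun e => [e.1, e.2] := fun h => by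
        have := hM4 v h
        simp [hvW] at this
      refine ⟨(u, v) :: M, by simp [hM1], ?_, ?_, ?_⟩
      · intro e he
        rcases List.mem_cons.1 he with rfl | he
        exacts [huv, hM2 e he]
      · simp only [List.flatMap_cons, List.cons_append, List.nil_append, List.nodup_cons,
          List.mem_cons, not_or]
        exact ⟨⟨huv.ne, hu'⟩, hv', hM3⟩
      · intro w hw
        simp only [List.flatMap_cons, List.cons_append, List.nil_append, List.mem_cons] at hw
        rcases hw with rfl | rfl | hw
        · exact hu
        · exact mem_union_right _ hv
        · exact union_subset_union (erase_subset _ _) hR' (hM4 w hw)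
    rcases W.eq_empty_or_nonempty with rfl | ⟨u, hu⟩
    · simp only [card_empty, add_zero] at h2
      obtain ⟨u, hu⟩ : R.Nonempty := card_pos.1 (by omega)
      obtain ⟨v, hv, huv⟩ := key u (mem_union_right _ hu)
      have : #((R.erase u).erase v) = #R - 1 - 1 := by
        rw [card_erase_of_mem (mem_erase.2 ⟨huv.ne', hv⟩), card_erase_of_mem hu]
      refine step u v (mem_union_right _ hu) hv huv ?_ ?_
      · omega
      · simp; omega
    · obtain ⟨v, hv, huv⟩ := key u (mem_union_left _ hu)
      have huR : u ∉ R := fun h => disjoint_left.1 hd hu h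
      have : #((R.erase u).erase v) = #R - 1 := by
        rw [erase_eq_of_notMem huR, card_erase_of_mem hv]
      have h5 : #(W.erase u) = #W - 1 := card_erase_of_mem hu
      have : 0 < #W := card_pos.2 ⟨u, hu⟩
      exact step u v (mem_union_left _ hu) hv huv (by omega) (by omega)

theorem exists_common_adj (Q : SimpleGraph ι) [DecidableRel Q.Adj] {f : ℕ} {R : Finset ι} {u v : ι}
    (hu : #{w ∈ R | ¬ Q.Adj u w} ≤ f) (hv : #{w ∈ R | ¬ Q.Adj v w} ≤ f) (hR : 2 * f < #R) :
    ∃ w ∈ R, Q.Adj u w ∧ Q.Adj v w := by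
  by_contra! hcon
  have : R ⊆ {w ∈ R | ¬ Q.Adj u w} ∪ {w ∈ R | ¬ Q.Adj v w} := by
    intro w hw
    by_cases h : Q.Adj u w
    · simp [hw, hcon w hw h]
    · simp [hw, h]
  have h1 := card_le_card this
  have h2 := card_union_le {w ∈ R | ¬ Q.Adj u w} {w ∈ R | ¬ Q.Adj v w}
  omega

theorem hasConnMatching_of_few_nonadj (Q : SimpleGraph ι) [DecidableRel Q.Adj] (f y : ℕ)
    (W R : Finset ι) (hd : Disjoint W R)
    (hf : ∀ u ∈ W ∪ R, #{v ∈ R | ¬ Q.Adj u v} ≤ f) (h1 : y + 2 * f ≤ #R)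
    (h2 : 2 * y + 2 * f ≤ #R + #W) : HasConnMatching Q y := by
  obtain ⟨M, hM1, hM2, hM3, hM4⟩ := exists_matching_of_few_nonadj Q f y W R hd hf h1 h2
  refine ⟨M, hM1, hM2, hM3, fun e he e' he' => ?_⟩
  have hy : 0 < y := hM1 ▸ List.length_pos_of_mem he
  have hmem : ∀ e ∈ M, e.1 ∈ W ∪ R := fun e he =>
    hM4 _ (List.mem_flatMap.2 ⟨e, he, by simp⟩)
  obtain ⟨w, -, hw1, hw2⟩ := exists_common_adj Q (hf _ (hmem e he)) (hf _ (hmem e' he')) (by omega)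
  exact hw1.reachable.trans hw2.symm.reachable

/-- If a matching of `P` inside `Z` is not extendable to a larger matching inside `Z`,
then one can choose an endpoint of each of its edges having at most one neighbour among the
uncovered vertices. -/
theorem exists_maximal_matching (P : SimpleGraph ι) [DecidableRel P.Adj] (Z : Finset ι) (x : ℕ)
    (hP : ∀ u ∈ Z, ∀ v ∈ Z, P.Reachable u v) (hx : ¬ HasConnMatching P x) :
    ∃ w < x, ∃ W R : Finset ι, W ⊆ Z ∧ R ⊆ Z ∧ Disjoint W R ∧ #W = w ∧ #R + 2 * w = #Z ∧
      (∀ u ∈ R, ∀ v ∈ R, ¬ P.Adj u v) ∧ ∀ u ∈ W, #{v ∈ R | P.Adj u v} ≤ 1 := by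
  let S : ℕ → Prop := fun q => ∃ M : List (ι × ι), M.length = q ∧ (∀ e ∈ M, P.Adj e.1 e.2) ∧
    (M.flatMap fun e => [e.1, e.2]).Nodup ∧ ∀ v ∈ M.flatMap fun e => [e.1, e.2], v ∈ Z
  have hSx : ¬ S x := fun ⟨M, h1, h2, h3, h4⟩ => hx ⟨M, h1, h2, h3, fun e he e' he' =>
    hP _ (h4 _ (List.mem_flatMap.2 ⟨e, he, by simp⟩)) _
      (h4 _ (List.mem_flatMap.2 ⟨e', he', by simp⟩))⟩
  have hS0 : S 0 := ⟨[], by simp⟩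
  obtain ⟨w, hwx, ⟨M, hM1, hM2, hM3, hM4⟩, hw'⟩ : ∃ w < x, S w ∧ ¬ S (w + 1) := by
    by_contra! hcon
    have : ∀ w ≤ x, S w := by
      intro w
      induction w with
      | zero => exact fun _ => hS0
      | succ w ih => exact fun h => hcon w (by omega) (ih (by omega))
    exact hSx (this x le_rfl)
  set F := M.flatMap fun e => [e.1, e.2] with hF
  have hlen : F.length = 2 * w := by
    rw [hF, List.length_flatMap]; simp [hM1, mul_comm]
  let R := Z \ F.toFinset
  have hRF : ∀ v ∈ R, v ∉ F := fun v hv => by simpa using (mem_sdiff.1 hv).2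
  have hRZ : R ⊆ Z := sdiff_subset
  have hRR : ∀ u ∈ R, ∀ v ∈ R, ¬ P.Adj u v := by
    intro u hu v hv huv
    refine hw' ⟨(u, v) :: M, by simp [hM1], ?_, ?_, ?_⟩
    · intro e he
      rcases List.mem_cons.1 he with rfl | he
      exacts [huv, hM2 e he]
    · simp only [List.flatMap_cons, List.cons_append, List.nil_append, List.nodup_cons,
          List.mem_cons, not_or]
      exact ⟨⟨huv.ne, hRF u hu⟩, hRF v hv, hM3⟩
    · intro z hz
      simp only [List.flatMap_cons, List.cons_append, List.nil_append, List.mem_cons] at hz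
      rcases hz with rfl | rfl | hz
      exacts [hRZ hu, hRZ hv, hM4 z hz]
  have haug : ∀ e ∈ M, 1 < #{v ∈ R | P.Adj e.1 v} → #{v ∈ R | P.Adj e.2 v} ≤ 1 := by
    intro e he h1
    by_contra! h2
    obtain ⟨a, ha⟩ := card_pos.1 (by omega : 0 < #{v ∈ R | P.Adj e.2 v})
    obtain ⟨b, hb, hba⟩ := exists_mem_ne h1 a
    rw [mem_filter] at ha hb
    have hperm := List.perm_cons_erase he
    have hpF : F.Perm (e.1 :: e.2 :: ((M.erase e).flatMap fun e => [e.1, e.2])) := by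
      simpa using hperm.flatMap_right (fun e : ι × ι => [e.1, e.2])
    have hnd := hpF.nodup_iff.1 hM3
    have haF : a ∉ e.1 :: e.2 :: ((M.erase e).flatMap fun e => [e.1, e.2]) :=
      fun h => hRF a ha.1 (hpF.mem_iff.2 h)
    have hbF : b ∉ e.1 :: e.2 :: ((M.erase e).flatMap fun e => [e.1, e.2]) :=
      fun h => hRF b hb.1 (hpF.mem_iff.2 h)
    have hZ : ∀ z ∈ e.1 :: e.2 :: ((M.erase e).flatMap fun e => [e.1, e.2]), z ∈ Z :=
      fun z hz => hM4 z (hpF.mem_iff.2 hz)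
    refine hw' ⟨(e.1, b) :: (e.2, a) :: M.erase e, ?_, ?_, ?_, ?_⟩
    · have := hperm.length_eq
      simp only [List.length_cons] at this ⊢
      omega
    · intro e' he'
      simp only [List.mem_cons] at he'
      rcases he' with rfl | rfl | he'
      exacts [hb.2, ha.2, hM2 e' (List.mem_of_mem_erase he')]
    · simp only [List.flatMap_cons, List.cons_append, List.nil_append, List.nodup_cons,
          List.mem_cons, not_or] at hnd haF hbF ⊢
      refine ⟨⟨Ne.symm hbF.1, hnd.1.1, Ne.symm haF.1, hnd.1.2⟩, ⟨hbF.2.1, hba, hbF.2.2⟩,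
        ⟨Ne.symm haF.2.1, hnd.2.1⟩, haF.2.2, hnd.2.2⟩
    · intro z hz
      simp only [List.flatMap_cons, List.cons_append, List.nil_append, List.mem_cons] at hz hZ
      rcases hz with rfl | rfl | rfl | rfl | hz
      · exact hZ _ (by simp)
      · exact hRZ hb.1
      · exact hZ _ (by simp)
      · exact hRZ ha.1
      · exact hZ _ (by simp only [hz, or_true])
  let pick : ι × ι → ι := fun e => if #{v ∈ R | P.Adj e.1 v} ≤ 1 then e.1 else e.2
  have hpick : ∀ e, pick e = e.1 ∨ pick e = e.2 := fun e => by
    simp only [pick]; split_ifs <;> simp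
  have hsub : (M.map pick).Sublist F := map_sublist_flatMap pick hpick M
  refine ⟨w, hwx, (M.map pick).toFinset, R, ?_, hRZ, ?_, ?_, ?_, hRR, ?_⟩
  · intro z hz
    exact hM4 z (hsub.subset (by simpa using hz))
  · rw [disjoint_left]
    intro z hz hzR
    exact hRF z hzR (hsub.subset (by simpa using hz))
  · rw [List.toFinset_card_of_nodup (hM3.sublist hsub)]; simp [hM1]
  · have hFZ : F.toFinset ⊆ Z := fun z hz => hM4 z (by simpa using hz)
    have h1 := card_sdiff_add_card_eq_card hFZ
    rw [List.toFinset_card_of_nodup hM3, hlen] at h1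
    exact h1
  · intro u hu
    simp only [List.mem_toFinset, List.mem_map] at hu
    obtain ⟨e, he, rfl⟩ := hu
    simp only [pick]
    split_ifs with h
    · exact h
    · exact haug e he (by omega)

theorem hasConnMatching_or_of_reachable (P Q : SimpleGraph ι) [DecidableRel P.Adj]
    [DecidableRel Q.Adj] (Z : Finset ι) (e x y : ℕ)
    (hP : ∀ u ∈ Z, ∀ v ∈ Z, P.Reachable u v)
    (hZ : ∀ u ∈ Z, #{v ∈ Z | ¬ P.Adj u v ∧ ¬ Q.Adj u v} ≤ e)
    (h1 : 2 * x + y + 2 * e + 2 ≤ #Z) (h2 : x + 2 * y + 2 * e + 2 ≤ #Z) :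
    HasConnMatching P x ∨ HasConnMatching Q y := by
  rw [or_iff_not_imp_left]
  intro hx
  obtain ⟨w, hw, W, R, hWZ, hRZ, hd, hWc, hRc, hRR, hWR⟩ := exists_maximal_matching P Z x hP hx
  refine hasConnMatching_of_few_nonadj Q (e + 1) y W R hd (fun u hu => ?_) (by omega) (by omega)
  have huZ : u ∈ Z := union_subset hWZ hRZ hu
  have hP1 : #{v ∈ R | P.Adj u v} ≤ 1 := by
    rcases mem_union.1 hu with hu | hu
    · exact hWR u hu
    · rw [filter_false_of_mem (hRR u hu)]; simp
  have hsub : {v ∈ R | ¬ Q.Adj u v} ⊆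
      {v ∈ Z | ¬ P.Adj u v ∧ ¬ Q.Adj u v} ∪ {v ∈ R | P.Adj u v} := by
    intro v hv
    rw [mem_filter] at hv
    by_cases h : P.Adj u v
    · simp [h, hv.1]
    · simp [h, hv.2, hRZ hv.1]
  have := card_le_card hsub
  have := card_union_le {v ∈ Z | ¬ P.Adj u v ∧ ¬ Q.Adj u v} {v ∈ R | P.Adj u v}
  have := hZ u huZ
  omega

/-- In a two-coloured almost complete graph on about `2 * x + y` vertices, `y ≤ x`, there is a
connected matching with `x` edges in the first colour or with `y` edges in the second one. -/
theorem hasConnMatching_or (P Q : SimpleGraph ι) [DecidableRel P.Adj]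
    [DecidableRel Q.Adj] (Z : Finset ι) (e x y : ℕ)
    (hZ : ∀ u ∈ Z, #{v ∈ Z | ¬ P.Adj u v ∧ ¬ Q.Adj u v} ≤ e)
    (h1 : 2 * x + y + 6 * e + 3 ≤ #Z) (hyx : y ≤ x) :
    HasConnMatching P x ∨ HasConnMatching Q y := by
  classical
  let S : Finset (Finset ι) := {X ∈ Z.powerset | 2 * e + 1 ≤ #X ∧
    ∀ u ∈ X, ∀ v ∈ Z, P.Reachable u v → v ∈ X}
  have hS : ∀ X, X ∈ S ↔ X ⊆ Z ∧ 2 * e + 1 ≤ #X ∧ ∀ u ∈ X, ∀ v ∈ Z, P.Reachable u v → v ∈ X := by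
    intro X; simp [S]
  obtain ⟨X, hXS, hmin⟩ := S.exists_min_image card
    ⟨Z, (hS Z).2 ⟨Subset.rfl, by omega, fun _ _ v hv _ => hv⟩⟩
  obtain ⟨hXZ, hXc, hcl⟩ := (hS X).1 hXS
  have hsd := card_sdiff_add_card_eq_card hXZ
  by_cases hbig : 2 * e + 1 ≤ #(Z \ X)
  · have hQ1 : ∀ u ∈ X, #{v ∈ Z \ X | ¬ Q.Adj u v} ≤ e := by
      intro u hu
      refine (card_le_card fun v hv => ?_).trans (hZ u (hXZ hu))
      simp only [mem_filter, mem_sdiff] at hv ⊢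
      exact ⟨hv.1.1, fun h => hv.1.2 (hcl u hu v hv.1.1 h.reachable), hv.2⟩
    have hQ2 : ∀ u ∈ Z \ X, #{v ∈ X | ¬ Q.Adj u v} ≤ e := by
      intro u hu
      rw [mem_sdiff] at hu
      refine (card_le_card fun v hv => ?_).trans (hZ u hu.1)
      simp only [mem_filter] at hv ⊢
      exact ⟨hXZ hv.1, fun h => hu.2 (hcl v hv.1 u hu.1 h.symm.reachable), hv.2⟩
    have hXX : ∀ u ∈ X, ∀ v ∈ X, Q.Reachable u v := fun u hu v hv => by
      obtain ⟨w, -, h1, h2⟩ := exists_common_adj Q (hQ1 u hu) (hQ1 v hv) (by omega)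
      exact h1.reachable.trans h2.symm.reachable
    have hYX : ∀ u ∈ Z, ∃ v ∈ X, Q.Reachable u v := fun u hu => by
      by_cases huX : u ∈ X
      · exact ⟨u, huX, .rfl⟩
      · have := hQ2 u (mem_sdiff.2 ⟨hu, huX⟩)
        obtain ⟨w, hw, h, -⟩ := exists_common_adj Q this this (by omega)
        exact ⟨w, hw, h.reachable⟩
    refine (hasConnMatching_or_of_reachable Q P Z e y x ?_ ?_ (by omega) (by omega)).symm
    · intro u hu v hv
      obtain ⟨u', hu', h1⟩ := hYX u hu
      obtain ⟨v', hv', h2⟩ := hYX v hv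
      exact (h1.trans (hXX u' hu' v' hv')).trans h2.symm
    · intro u hu
      simpa only [and_comm] using hZ u hu
  · refine hasConnMatching_or_of_reachable P Q X e x y ?_ ?_ (by omega) (by omega)
    · by_contra! hcon
      obtain ⟨u, hu, v, hv, huv⟩ := hcon
      let X₁ : Finset ι := {w ∈ X | P.Reachable u w}
      let X₂ : Finset ι := {w ∈ X | ¬ P.Reachable u w}
      have hcard : #X₁ + #X₂ = #X := card_filter_add_card_filter_not _
      have hX₁ : 0 < #X₁ := card_pos.2 ⟨u, by simp [X₁, hu]⟩
      have hX₂ : 0 < #X₂ := card_pos.2 ⟨v, by simp [X₂, hv, huv]⟩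
      have hn₁ : X₁ ∉ S := fun h => by have := hmin _ h; omega
      have hn₂ : X₂ ∉ S := fun h => by have := hmin _ h; omega
      have hc₁ : #X₁ < 2 * e + 1 := by
        by_contra! h
        refine hn₁ ((hS _).2 ⟨(filter_subset _ _).trans hXZ, h, fun a ha b hb hab => ?_⟩)
        simp only [X₁, mem_filter] at ha ⊢
        exact ⟨hcl a ha.1 b hb hab, ha.2.trans hab⟩
      have hc₂ : #X₂ < 2 * e + 1 := by
        by_contra! h
        refine hn₂ ((hS _).2 ⟨(filter_subset _ _).trans hXZ, h, fun a ha b hb hab => ?_⟩)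
        simp only [X₂, mem_filter] at ha ⊢
        exact ⟨hcl a ha.1 b hb hab, fun h' => ha.2 (h'.trans hab.symm)⟩
      omega
    · intro u hu
      exact (card_le_card (filter_subset_filter _ hXZ)).trans (hZ u (hXZ hu))

end Matching

section Embedding

open Finset

theorem SimpleGraph.exists_zigzag_walk {ι : Type*} [DecidableEq ι] (R : SimpleGraph ι) {a b : ι}
    (hab : R.Adj a b) (n : ℕ) : ∃ w : R.Walk a a, w.length = 2 * n ∧
      ∀ j, w.support.count j ≤ 1 + if j = a ∨ j = b then n else 0 := by
  induction n with
  | zero => exact ⟨.nil, rfl, fun j => by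
      simpa using List.count_le_length (a := j) (l := [a])⟩
  | succ n ih =>
    obtain ⟨w, hw, hc⟩ := ih
    refine ⟨.cons hab (.cons hab.symm w), by simp [hw]; ring, fun j => ?_⟩
    have := hc j
    have hne := hab.ne
    simp only [SimpleGraph.Walk.support_cons, List.count_cons, beq_iff_eq]
    by_cases h1 : a = j
    · subst h1; simp [hne.symm] at this ⊢; omega
    · by_cases h2 : b = j
      · subst h2; simp [hne] at this ⊢; omega
      · simp [h1, h2, Ne.symm h1, Ne.symm h2] at this ⊢; omega

/-- In a graph with a list `M` of disjoint edges reachable from `r` there are closed walks at `r` of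
every even length in a long interval, which visit the ends of each edge about `t` times and
every other vertex a bounded number of times. -/
theorem SimpleGraph.exists_closed_walk_through_matching {ι : Type*} [DecidableEq ι] [Fintype ι]
    (R : SimpleGraph ι) (r : ι) (t : ℕ) (M : List (ι × ι)) (hadj : ∀ e ∈ M, R.Adj e.1 e.2)
    (hnd : (M.flatMap fun e => [e.1, e.2]).Nodup) (hr : ∀ e ∈ M, R.Reachable r e.1) :
    ∃ d ≤ Fintype.card ι * M.length, ∀ n ≤ M.length * t, ∃ w : R.Walk r r,
      w.length = 2 * (n + d) ∧ ∀ j, w.support.count j ≤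
        1 + 3 * M.length + if j ∈ M.flatMap fun e => [e.1, e.2] then t else 0 := by
  induction M with
  | nil => 
    refine ⟨0, by simp, fun n hn => ⟨.nil, ?_, fun j => ?_⟩⟩
    · simp at hn ⊢; exact hn
    · simpa using List.count_le_length (a := j) (l := [r])
  | cons e M ih =>
    simp only [List.flatMap_cons, List.cons_append, List.nil_append, List.nodup_cons,
      List.mem_cons, not_or] at hnd
    obtain ⟨d, hd, hw⟩ := ih (fun e' he' => hadj e' (List.mem_cons_of_mem _ he')) hnd.2.2
      (fun e' he' => hr e' (List.mem_cons_of_mem _ he'))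
    obtain ⟨q, hq⟩ := (hr e (by simp)).exists_isPath
    have hql := hq.length_lt
    refine ⟨d + q.length, ?_, fun n hn => ?_⟩
    · rw [List.length_cons, mul_add, mul_one]; omega
    rw [List.length_cons, add_mul, one_mul] at hn
    obtain ⟨w, hwl, hwc⟩ := hw (n - min n t) (by omega)
    obtain ⟨z, hzl, hzc⟩ := R.exists_zigzag_walk (hadj e (by simp)) (min n t)
    refine ⟨((q.append z).append q.reverse).append w, ?_, fun j => ?_⟩
    · simp only [SimpleGraph.Walk.length_append, SimpleGraph.Walk.length_reverse, hwl, hzl]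
      omega
    · have h1 : q.support.count j ≤ 1 := List.nodup_iff_count_le_one.1 hq.support_nodup j
      have h2 : q.reverse.support.tail.count j ≤ 1 := by
        refine ((List.tail_sublist _).count_le j).trans ?_
        rw [SimpleGraph.Walk.support_reverse, List.count_reverse]; exact h1
      have h3 := (List.tail_sublist z.support).count_le j
      have h4 := (List.tail_sublist w.support).count_le j
      have h5 := hwc j
      have h6 := hzc j
      have h7 : min n t ≤ t := min_le_right _ _
      simp only [SimpleGraph.Walk.support_append, List.count_append, List.flatMap_cons,
        List.cons_append, List.nil_append, List.mem_cons, List.length_cons]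
      by_cases hj : j = e.1 ∨ j = e.2
      · have : j ∉ M.flatMap fun e => [e.1, e.2] := by
          rcases hj with rfl | rfl
          exacts [hnd.1.2, hnd.2.1]
        have h8 : j = e.1 ∨ j = e.2 ∨ j ∈ M.flatMap fun e => [e.1, e.2] := by tauto
        rw [if_pos h8]
        rw [if_neg this] at h5
        rw [if_pos hj] at h6
        omega
      · rw [if_neg hj] at h6
        have h8 : (j = e.1 ∨ j = e.2 ∨ j ∈ M.flatMap fun e => [e.1, e.2]) ↔
          j ∈ M.flatMap fun e => [e.1, e.2] := by tauto
        simp only [h8]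
        omega

/-- `H` is linked along `R`: for every edge `ij` of `R`, all subsets `X` of `C i` and `Y` of
`C j` with at least `β` elements contain a vertex of `X` adjacent to a proportion `κ` of `Y`. -/
def LinkedAlong {V ι : Type*} (H : SimpleGraph V) [DecidableRel H.Adj] (R : SimpleGraph ι)
    (C : ι → Finset V) (β : ℕ) (κ : ℝ) : Prop :=
  ∀ i j, R.Adj i j → ∀ X ⊆ C i, ∀ Y ⊆ C j, β ≤ #X → β ≤ #Y →
    ∃ x ∈ X, κ * #Y ≤ #{y ∈ Y | H.Adj x y}

variable {V ι : Type*} [DecidableEq V] [DecidableEq ι] {H : SimpleGraph V} [DecidableRel H.Adj]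
  {R : SimpleGraph ι} {C : ι → Finset V} {β T : ℕ} {κ : ℝ}

/-- A walk in the reduced graph lifts to a path in `H` avoiding a prescribed set `U`, and ending
at a prescribed vertex `z` through a prescribed set `S` of its neighbours. -/
theorem LinkedAlong.exists_path (hL : LinkedAlong H R C β κ)
    (hC : ∀ i j, i ≠ j → Disjoint (C i) (C j)) (hκ : 0 < κ) (hβ : 1 ≤ β)
    (hT : (β : ℝ) ≤ κ * T) (hβT : β ≤ T) {z : V} {S : Finset V} {s : ι} (hS : S ⊆ C s)
    (hSβ : β ≤ #S) (hzS : ∀ y ∈ S, H.Adj y z) {i r : ι} (w : R.Walk i r) (hrs : R.Adj r s) :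
    ∀ X U : Finset V, X ⊆ C i → Disjoint X U → β ≤ #X → S ⊆ U → z ∈ U →
      (∀ j, w.support.count j + T ≤ #(C j \ U)) →
      ∃ x ∈ X, ∃ p : H.Walk x z, p.IsPath ∧ p.length = w.length + 2 ∧
        ∀ y ∈ p.support, y ∈ S ∨ y = z ∨ y ∉ U := by
  induction w with
  | @nil i =>
    intro X U hX hXU hXβ hSU hzU _
    obtain ⟨x, hx, hxS⟩ := hL _ _ hrs X hX S hS hXβ hSβ
    have hpos : (0 : ℝ) < #{y ∈ S | H.Adj x y} :=
      lt_of_lt_of_le (mul_pos hκ (by exact_mod_cast lt_of_lt_of_le hβ hSβ)) hxS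
    obtain ⟨y, hy⟩ := card_pos.1 (Nat.cast_pos.1 hpos)
    rw [mem_filter] at hy
    have hxU : x ∉ U := disjoint_left.1 hXU hx
    have hxz : x ≠ z := fun h => hxU (h ▸ hzU)
    refine ⟨x, hx, .cons hy.2 (.cons (hzS y hy.1) .nil), ?_, by simp, ?_⟩
    · simp [SimpleGraph.Walk.cons_isPath_iff, (hzS y hy.1).ne, hy.2.ne, hxz]
    · intro v hv
      simp only [SimpleGraph.Walk.support_cons, SimpleGraph.Walk.support_nil, List.mem_cons,
        List.not_mem_nil, or_false] at hv
      rcases hv with rfl | rfl | rfl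
      exacts [.inr (.inr hxU), .inl hy.1, .inr (.inl rfl)]
  | @cons i i' r hii' w ih =>
    intro X U hX hXU hXβ hSU hzU hcount
    have hbig : T ≤ #(C i' \ U) := le_trans (Nat.le_add_left _ _) (hcount i')
    obtain ⟨x, hx, hxY⟩ := hL _ _ hii' X hX (C i' \ U) sdiff_subset hXβ (hβT.trans hbig)
    have hxU : x ∉ U := disjoint_left.1 hXU hx
    have hxC : ∀ j, i ≠ j → x ∉ C j := fun j hj h => disjoint_left.1 (hC _ _ hj) (hX hx) h
    have hXβ' : β ≤ #{y ∈ C i' \ U | H.Adj x y} := by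
      have h1 : κ * T ≤ κ * #(C i' \ U) := by gcongr
      exact_mod_cast hT.trans (h1.trans hxY)
    obtain ⟨x', hx', p, hp, hpl, hps⟩ := ih hrs {y ∈ C i' \ U | H.Adj x y} (insert x U)
      ((filter_subset _ _).trans sdiff_subset) (by
        rw [disjoint_left]
        intro y hy hy'
        simp only [mem_filter, mem_sdiff, mem_insert] at hy hy'
        rcases hy' with rfl | hy'
        exacts [H.irrefl hy.2, hy.1.2 hy']) hXβ' (hSU.trans (subset_insert _ _))
      (mem_insert_of_mem hzU) (by
        intro j
        have hj := hcount j
        rw [SimpleGraph.Walk.support_cons, List.count_cons] at hj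
        by_cases hij : i = j
        · subst hij
          have : C i \ insert x U = (C i \ U).erase x := by
            ext y; simp only [mem_sdiff, mem_insert, mem_erase]; tauto
          rw [this, card_erase_of_mem (by simp [hX hx, hxU])]
          simp at hj
          omega
        · have : C j \ insert x U = C j \ U := by
            ext y
            simp only [mem_sdiff, mem_insert]
            have : y ∈ C j → y ≠ x := fun h h' => hxC j hij (h' ▸ h)
            tauto
          rw [this]
          omega)
    rw [mem_filter] at hx'
    refine ⟨x, hx, .cons hx'.2 p, ?_, by simp [hpl], ?_⟩
    · refine (SimpleGraph.Walk.cons_isPath_iff _ _).2 ⟨hp, fun hxp => ?_⟩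
      rcases hps x hxp with h | h | h
      exacts [hxU (hSU h), hxU (h ▸ hzU), h (mem_insert_self _ _)]
    · intro y hy
      rw [SimpleGraph.Walk.support_cons, List.mem_cons] at hy
      rcases hy with rfl | hy
      · exact .inr (.inr hxU)
      · rcases hps y hy with h | h | h
        exacts [.inl h, .inr (.inl h), .inr (.inr fun h' => h (mem_insert_of_mem h'))]

theorem SimpleGraph.Walk.IsPath.cons_isCycle {V : Type*} {G : SimpleGraph V} {u v : V}
    {p : G.Walk v u} (hp : p.IsPath) (h : G.Adj u v) (hl : 2 ≤ p.length) :
    (SimpleGraph.Walk.cons h p).IsCycle := by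
  refine (SimpleGraph.Walk.cons_isCycle_iff _ _).2 ⟨hp, fun hmem => ?_⟩
  cases p with
  | nil => simp at hl
  | @cons _ y _ hvy q =>
    rw [SimpleGraph.Walk.cons_isPath_iff] at hp
    rw [SimpleGraph.Walk.edges_cons, List.mem_cons] at hmem
    rcases hmem with hmem | hmem
    · have huy : u = y := by
        rcases Sym2.eq_iff.1 hmem with ⟨h1, h2⟩ | ⟨h1, -⟩
        exacts [h1.trans h2, h1]
      subst huy
      have := hp.1
      rw [SimpleGraph.Walk.isPath_iff_nil, ← SimpleGraph.Walk.length_eq_zero_iff] at this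
      simp [this] at hl
    · exact hp.2 (q.snd_mem_support_of_mem_edges hmem)

/-- A connected matching in the reduced graph yields cycles of every prescribed even length up to
almost the number of vertices it covers. -/
theorem LinkedAlong.exists_isCycle [Fintype ι] (hL : LinkedAlong H R C β κ)
    (hC : ∀ i j, i ≠ j → Disjoint (C i) (C j)) (hκ : 0 < κ) (hβ : 1 ≤ β)
    (hT : 2 * (β : ℝ) ≤ κ * T) (hβT : β ≤ T) {q t m a : ℕ} (hq : 1 ≤ q)
    (hM : HasConnMatching R q) (hm : ∀ i, m ≤ #(C i)) (h1 : Fintype.card ι * q + 2 ≤ a)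
    (h2 : a ≤ q * t) (h3 : t + 3 * q + 3 + β + T ≤ m) :
    ∃ (v : V) (w : H.Walk v v), w.IsCycle ∧ w.length = 2 * a := by
  obtain ⟨M, rfl, hadj, hnd, hreach⟩ := hM
  obtain ⟨e, he⟩ := List.exists_mem_of_length_pos hq
  obtain ⟨d, hd, hwalk⟩ := R.exists_closed_walk_through_matching e.1 t M hadj hnd
    (hreach e he)
  obtain ⟨w, hwl, hwc⟩ := hwalk (a - 2 - d) (by omega)
  have hee := hadj e he
  obtain ⟨z, hz, hzN⟩ := hL _ _ hee (C e.1) Subset.rfl (C e.2) Subset.rfl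
    ((by omega : β ≤ m).trans (hm _)) ((by omega : β ≤ m).trans (hm _))
  have hN : 2 * β ≤ #{y ∈ C e.2 | H.Adj z y} := by
    have hTC : T ≤ #(C e.2) := (by omega : T ≤ m).trans (hm _)
    have h1 : κ * T ≤ κ * #(C e.2) := by gcongr
    exact_mod_cast hT.trans (h1.trans hzN)
  obtain ⟨S, hSN, hSc⟩ := exists_subset_card_eq (by omega : β ≤ #{y ∈ C e.2 | H.Adj z y})
  have hNC : {y ∈ C e.2 | H.Adj z y} ⊆ C e.2 := filter_subset _ _
  have hSadj : ∀ y ∈ {y ∈ C e.2 | H.Adj z y}, H.Adj z y := fun y hy => (mem_filter.1 hy).2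
  obtain ⟨x, hx, p, hp, hpl, -⟩ := hL.exists_path hC hκ hβ (by linarith) hβT (z := z)
    (hSN.trans hNC) hSc.ge (fun y hy => (hSadj y (hSN hy)).symm) (.cons hee.symm w) hee
    ({y ∈ C e.2 | H.Adj z y} \ S) (insert z S) (sdiff_subset.trans hNC) (by
      rw [disjoint_left]
      intro y hy hy'
      rw [mem_sdiff] at hy
      rcases mem_insert.1 hy' with rfl | hy'
      exacts [H.irrefl (hSadj _ hy.1), hy.2 hy']) (by
      rw [card_sdiff_of_subset hSN]; omega) (subset_insert _ _) (mem_insert_self _ _) (by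
      intro j
      have h4 := le_card_sdiff (insert z S) (C j)
      have h5 := card_insert_le z S
      have h6 := hwc j
      have h7 := hm j
      have h8 : (if j ∈ M.flatMap fun e => [e.1, e.2] then t else 0) ≤ t := by
        split_ifs <;> simp
      have h9 : (if e.2 == j then 1 else 0) ≤ 1 := by split_ifs <;> simp
      rw [SimpleGraph.Walk.support_cons, List.count_cons]
      omega)
  refine ⟨z, .cons (hSadj x (sdiff_subset hx)) p, hp.cons_isCycle _ (by omega), ?_⟩
  simp only [SimpleGraph.Walk.length_cons] at hpl ⊢
  omega

end Embedding

section Probability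

open Finset

/-- Every two disjoint sets of at least `s` vertices have edge density at least `c` in `G`. -/
def LowerDense {V : Type*} (G : SimpleGraph V) [DecidableRel G.Adj] (s c : ℝ) : Prop :=
  ∀ A B : Finset V, Disjoint A B → s ≤ #A → s ≤ #B → c * (#A * #B) ≤ #(G.interedges A B)

/-- The non-loops among the unordered pairs of vertices. -/
def allPairs (N : ℕ) : Finset (Sym2 (Fin N)) := {e | ¬ e.IsDiag}

theorem card_allPairs (N : ℕ) : #(allPairs N) = N.choose 2 := by
  rw [allPairs, ← Fintype.card_subtype, Sym2.card_subtype_not_diag, Fintype.card_fin]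

open Classical in
theorem sum_simpleGraph_eq_sum_powerset (N : ℕ) (f : Finset (Sym2 (Fin N)) → ℝ) :
    ∑ G : SimpleGraph (Fin N), f G.edgeFinset = ∑ S ∈ (allPairs N).powerset, f S := by
  refine Finset.sum_bij (fun G _ => G.edgeFinset) ?_ ?_ ?_ ?_
  · intro G _
    rw [mem_powerset]
    intro e he
    simpa [allPairs] using G.not_isDiag_of_mem_edgeFinset he
  · intro G _ G' _ h
    exact SimpleGraph.edgeFinset_inj.1 h
  · intro S hS
    rw [mem_powerset] at hS
    refine ⟨SimpleGraph.fromEdgeSet S, mem_univ _, ?_⟩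
    ext e
    simp only [SimpleGraph.mem_edgeFinset, SimpleGraph.edgeSet_fromEdgeSet, Set.mem_sdiff, mem_coe]
    refine ⟨fun h => h.1, fun h => ⟨h, ?_⟩⟩
    simpa [allPairs] using hS h
  · intros; rfl

open Classical in
theorem graphProbability_eq_sum (N : ℕ) (p : ℝ) (E : Set (SimpleGraph (Fin N))) :
    graphProbability N p E = ∑ G : SimpleGraph (Fin N), if G ∈ E then
      p ^ #G.edgeFinset * (1 - p) ^ (#(allPairs N) - #G.edgeFinset) else 0 := by
  simp only [graphProbability, card_allPairs, Nat.card_eq_fintype_card, SimpleGraph.edgeFinset_card]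

open Classical in
theorem graphProbability_univ (N : ℕ) (p : ℝ) : graphProbability N p Set.univ = 1 := by
  rw [graphProbability_eq_sum]
  simp only [Set.mem_univ, if_true]
  rw [sum_simpleGraph_eq_sum_powerset N
    fun S => p ^ #S * (1 - p) ^ (#(allPairs N) - #S), Finset.sum_pow_mul_eq_add_pow]
  simp

theorem graphProbability_mono {N : ℕ} {p : ℝ} (hp0 : 0 ≤ p) (hp1 : p ≤ 1)
    {E E' : Set (SimpleGraph (Fin N))} (h : E ⊆ E') :
    graphProbability N p E ≤ graphProbability N p E' := by
  refine Finset.sum_le_sum fun G _ => ?_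
  have : 0 ≤ 1 - p := by linarith
  split_ifs with h1 h2 h2
  · rfl
  · exact absurd (h h1) h2
  · positivity
  · rfl

theorem graphProbability_compl (N : ℕ) (p : ℝ) (E : Set (SimpleGraph (Fin N))) :
    graphProbability N p E = 1 - graphProbability N p Eᶜ := by
  rw [← graphProbability_univ N p, eq_sub_iff_add_eq]
  simp only [graphProbability, ← Finset.sum_add_distrib]
  refine Finset.sum_congr rfl fun G _ => ?_
  by_cases h : G ∈ E <;> simp [h]

open Classical in
theorem graphProbability_iUnion_le {N : ℕ} {p : ℝ} (hp0 : 0 ≤ p) (hp1 : p ≤ 1) {κ : Type*}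
    (s : Finset κ) (E : κ → Set (SimpleGraph (Fin N))) :
    graphProbability N p (⋃ i ∈ s, E i) ≤ ∑ i ∈ s, graphProbability N p (E i) := by
  simp only [graphProbability]
  rw [Finset.sum_comm]
  refine Finset.sum_le_sum fun G _ => ?_
  have : 0 ≤ 1 - p := by linarith
  have hnn : ∀ i ∈ s, 0 ≤ if G ∈ E i then
      p ^ (Nat.card G.edgeSet) * (1 - p) ^ (N.choose 2 - Nat.card G.edgeSet) else 0 := by
    intro i _; split_ifs <;> positivity
  split_ifs with h
  · simp only [Set.mem_iUnion] at h
    obtain ⟨i, hi, hG⟩ := h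
    have := Finset.single_le_sum hnn hi
    rwa [if_pos hG] at this
  · exact Finset.sum_nonneg hnn

open Classical in
/-- Lower tail bound for the number of edges inside a set `T` of pairs. -/
theorem graphProbability_few_edges_le (N : ℕ) {p : ℝ} (hp0 : 0 ≤ p) (hp1 : p ≤ 1)
    (T : Finset (Sym2 (Fin N))) (hT : T ⊆ allPairs N) :
    graphProbability N p {G | (#(G.edgeFinset ∩ T) : ℝ) ≤ p / 4 * #T} ≤
      Real.exp (-(p / 4 * #T)) := by
  have hp2 : 0 ≤ 1 - p := by linarith
  set F : Finset (Sym2 (Fin N)) → ℝ := fun S => p ^ #S * (1 - p) ^ (#(allPairs N) - #S) *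
    ((1 / 2 : ℝ) ^ #(S ∩ T) * Real.exp (p / 4 * #T)) with hF
  have h1 : graphProbability N p {G | (#(G.edgeFinset ∩ T) : ℝ) ≤ p / 4 * #T} ≤
      ∑ G : SimpleGraph (Fin N), F G.edgeFinset := by
    rw [graphProbability_eq_sum]
    refine Finset.sum_le_sum fun G _ => ?_
    split_ifs with h
    · simp only [hF]
      refine le_mul_of_one_le_right (by positivity) ?_
      have h2 : Real.exp (-(#(G.edgeFinset ∩ T) : ℝ)) ≤ (1 / 2 : ℝ) ^ #(G.edgeFinset ∩ T) := by
        rw [← mul_one (#(G.edgeFinset ∩ T) : ℝ), ← mul_neg, Real.exp_nat_mul]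
        gcongr
        rw [Real.exp_neg, ← one_div]
        have := Real.exp_one_gt_d9
        exact one_div_le_one_div_of_le (by norm_num) (by linarith)
      have h3 : (1 : ℝ) ≤ Real.exp (-(#(G.edgeFinset ∩ T) : ℝ)) * Real.exp (p / 4 * #T) := by
        rw [← Real.exp_add]
        apply Real.one_le_exp
        have : (#(G.edgeFinset ∩ T) : ℝ) ≤ p / 4 * #T := h
        linarith
      exact h3.trans (by gcongr)
    · simp only [hF]; positivity
  refine h1.trans ?_
  rw [sum_simpleGraph_eq_sum_powerset N F]
  have h4 : ∑ S ∈ (allPairs N).powerset, F S =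
      (∏ e ∈ allPairs N, (p * (if e ∈ T then 1 / 2 else 1) + (1 - p))) *
        Real.exp (p / 4 * #T) := by
    rw [Finset.prod_add, Finset.sum_mul]
    refine Finset.sum_congr rfl fun S hS => ?_
    rw [mem_powerset] at hS
    simp only [hF]
    rw [Finset.prod_mul_distrib, Finset.prod_const, Finset.prod_const, card_sdiff_of_subset hS,
      Finset.prod_ite, Finset.prod_const, Finset.prod_const_one, mul_one,
      Finset.filter_mem_eq_inter]
    ring
  have h5 : ∏ e ∈ allPairs N, (p * (if e ∈ T then 1 / 2 else 1) + (1 - p)) =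
      (1 - p / 2) ^ #T := by
    have : ∀ e, (p * (if e ∈ T then 1 / 2 else 1) + (1 - p)) =
        if e ∈ T then 1 - p / 2 else 1 := by
      intro e; split_ifs <;> ring
    simp only [this]
    rw [Finset.prod_ite, Finset.prod_const, Finset.prod_const_one, mul_one,
      Finset.filter_mem_eq_inter, inter_eq_right.2 hT]
  rw [h4, h5]
  have h6 : (1 - p / 2) ^ #T ≤ Real.exp (-(p / 2)) ^ #T := by
    have := Real.add_one_le_exp (-(p / 2))
    gcongr
    · linarith
    · linarith
  calc (1 - p / 2) ^ #T * Real.exp (p / 4 * #T)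
      ≤ Real.exp (-(p / 2)) ^ #T * Real.exp (p / 4 * #T) := by gcongr
    _ = Real.exp (-(p / 4 * #T)) := by
      rw [← Real.exp_nat_mul, ← Real.exp_add]
      congr 1; ring

open Classical in
theorem graphProbability_not_lowerDense_le (N : ℕ) {p : ℝ} (hp0 : 0 ≤ p) (hp1 : p ≤ 1) {s : ℝ}
    (hs : 0 ≤ s) :
    graphProbability N p {G | ¬ LowerDense G s (p / 4)} ≤ 4 ^ N * Real.exp (-(p / 4 * s ^ 2)) := by
  let I : Finset (Finset (Fin N) × Finset (Fin N)) :=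
    {x | Disjoint x.1 x.2 ∧ s ≤ #x.1 ∧ s ≤ #x.2}
  let T : Finset (Fin N) × Finset (Fin N) → Finset (Sym2 (Fin N)) :=
    fun x => (x.1 ×ˢ x.2).image fun e => s(e.1, e.2)
  have hTsub : ∀ x ∈ I, T x ⊆ allPairs N := by
    intro x hx e he
    simp only [I, mem_filter, mem_univ, true_and] at hx
    simp only [T, mem_image, mem_product] at he
    obtain ⟨⟨a, b⟩, ⟨ha, hb⟩, rfl⟩ := he
    simp only [allPairs, mem_filter, mem_univ, true_and, Sym2.mk_isDiag_iff]
    rintro rfl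
    exact disjoint_left.1 hx.1 ha hb
  have hTcard : ∀ x ∈ I, #(T x) = #x.1 * #x.2 := by
    intro x hx
    simp only [I, mem_filter, mem_univ, true_and] at hx
    rw [← card_product]
    refine card_image_of_injOn ?_
    rintro ⟨a, b⟩ hab ⟨a', b'⟩ hab' h
    simp only [coe_product, Set.mem_prod, mem_coe] at hab hab'
    rcases Sym2.eq_iff.1 h with ⟨h1, h2⟩ | ⟨h1, h2⟩
    · exact Prod.ext h1 h2
    · dsimp only at h1 h2
      exact absurd hab'.2 (h1 ▸ disjoint_left.1 hx.1 hab.1)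
  have hsub : {G | ¬ LowerDense G s (p / 4)} ⊆
      ⋃ x ∈ I, {G : SimpleGraph (Fin N) | (#(G.edgeFinset ∩ T x) : ℝ) ≤ p / 4 * #(T x)} := by
    intro G hG
    simp only [Set.mem_ofPred, LowerDense, not_forall] at hG
    obtain ⟨A, B, hd, hA, hB, h⟩ := hG
    have hI : (A, B) ∈ I := by simp [I, hd, hA, hB]
    simp only [Set.mem_iUnion]
    refine ⟨(A, B), hI, ?_⟩
    have hle : #(G.edgeFinset ∩ T (A, B)) ≤ #(G.interedges A B) := by
      refine (card_le_card (t := (G.interedges A B).image fun e => s(e.1, e.2)) ?_).trans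
        card_image_le
      intro e he
      simp only [T, mem_inter, mem_image, mem_product, SimpleGraph.mem_edgeFinset] at he
      obtain ⟨he, ⟨a, b⟩, hab, rfl⟩ := he
      exact mem_image.2 ⟨(a, b), (SimpleGraph.mem_interedges_iff _).2 ⟨hab.1, hab.2, he⟩, rfl⟩
    have hle' : (#(G.edgeFinset ∩ T (A, B)) : ℝ) ≤ #(G.interedges A B) := by exact_mod_cast hle
    show (#(G.edgeFinset ∩ T (A, B)) : ℝ) ≤ p / 4 * #(T (A, B))
    rw [hTcard _ hI]
    push_cast
    linarith
  calc graphProbability N p {G | ¬ LowerDense G s (p / 4)}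
      ≤ ∑ x ∈ I, graphProbability N p {G | (#(G.edgeFinset ∩ T x) : ℝ) ≤ p / 4 * #(T x)} :=
        (graphProbability_mono hp0 hp1 hsub).trans (graphProbability_iUnion_le hp0 hp1 I _)
    _ ≤ ∑ x ∈ I, Real.exp (-(p / 4 * s ^ 2)) := by
        refine Finset.sum_le_sum fun x hx =>
          (graphProbability_few_edges_le N hp0 hp1 (T x) (hTsub x hx)).trans ?_
        rw [hTcard x hx]
        simp only [I, mem_filter, mem_univ, true_and] at hx
        have : s ^ 2 ≤ #x.1 * #x.2 := by
          rw [sq]; exact mul_le_mul hx.2.1 hx.2.2 hs (by positivity)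
        push_cast
        gcongr
    _ ≤ 4 ^ N * Real.exp (-(p / 4 * s ^ 2)) := by
        rw [sum_const, nsmul_eq_mul]
        gcongr
        have : #I ≤ 4 ^ N := by
          refine (card_le_univ I).trans ?_
          rw [Fintype.card_prod, Fintype.card_finset, Fintype.card_fin, ← mul_pow]
          norm_num
        exact_mod_cast this

open Classical in
theorem tendsto_graphProbability_lowerDense {p γ : ℝ} (hp0 : 0 < p) (hp1 : p ≤ 1) (hγ : 0 < γ) :
    Filter.Tendsto (fun N : ℕ => graphProbability N p {G | LowerDense G (γ * N) (p / 4)})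
      Filter.atTop (nhds 1) := by
  have hbad : Filter.Tendsto
      (fun N : ℕ => graphProbability N p {G | LowerDense G (γ * N) (p / 4)}ᶜ)
      Filter.atTop (nhds 0) := by
    have hexp : Filter.Tendsto (fun N : ℕ => Real.exp (-(N : ℝ))) Filter.atTop (nhds 0) :=
      Real.tendsto_exp_neg_atTop_nhds_zero.comp tendsto_natCast_atTop_atTop
    refine squeeze_zero' (Filter.Eventually.of_forall fun N => ?_) ?_ hexp
    · refine Finset.sum_nonneg fun G _ => ?_
      have : 0 ≤ 1 - p := by linarith
      split_ifs <;> positivity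
    · have hc : 0 < p / 4 * γ ^ 2 := by positivity
      filter_upwards [Filter.eventually_ge_atTop ⌈3 / (p / 4 * γ ^ 2)⌉₊] with N hN
      have hN' : 3 ≤ p / 4 * γ ^ 2 * N := by
        have := Nat.ceil_le.1 hN
        rw [div_le_iff₀ hc] at this
        linarith
      refine (graphProbability_not_lowerDense_le N hp0.le hp1 (by positivity)).trans ?_
      have h4 : (4 : ℝ) ^ N ≤ Real.exp (2 * N) := by
        have h2 : (2 : ℝ) ≤ Real.exp 1 := by
          have := Real.exp_one_gt_d9; linarith
        have : (4 : ℝ) ≤ Real.exp 1 ^ 2 := by nlinarith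
        calc (4 : ℝ) ^ N ≤ (Real.exp 1 ^ 2) ^ N := by gcongr
          _ = Real.exp (2 * N) := by
            rw [← pow_mul, ← Real.exp_nat_mul]; push_cast; ring_nf
      calc (4 : ℝ) ^ N * Real.exp (-(p / 4 * (γ * N) ^ 2))
          ≤ Real.exp (2 * N) * Real.exp (-(p / 4 * (γ * N) ^ 2)) := by gcongr
        _ = Real.exp (2 * N - p / 4 * (γ * N) ^ 2) := by rw [← Real.exp_add]; ring_nf
        _ ≤ Real.exp (-N) := by
          gcongr
          nlinarith [mul_le_mul_of_nonneg_right hN' (Nat.cast_nonneg N : (0 : ℝ) ≤ N)]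
  have h1 : Filter.Tendsto
      (fun N : ℕ => 1 - graphProbability N p {G | LowerDense G (γ * N) (p / 4)}ᶜ)
      Filter.atTop (nhds (1 - 0)) := hbad.const_sub 1
  rw [sub_zero] at h1
  exact h1.congr fun N => (graphProbability_compl N p _).symm

end Probability

section Regularity

open Finset

/-- The graph on the index set of a family of vertex sets `C`, in which `i` and `j` are adjacent if
all subsets of `C i` and `C j` with at least `β` elements have edge density at least `κ` in `H`. -/
def linkGraph {V ι : Type*} (H : SimpleGraph V) [DecidableRel H.Adj] (C : ι → Finset V) (β : ℕ)
    (κ : ℝ) : SimpleGraph ι where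
  Adj i j := i ≠ j ∧ ∀ X ⊆ C i, ∀ Y ⊆ C j, β ≤ #X → β ≤ #Y →
    κ * (#X * #Y) ≤ #(H.interedges X Y)
  symm := ⟨fun i j h => ⟨h.1.symm, fun X hX Y hY hXβ hYβ => by
    have h1 := h.2 Y hY X hX hYβ hXβ
    have : Std.Symm H.Adj := ⟨fun _ _ h => h.symm⟩
    have h2 : #(H.interedges X Y) = #(H.interedges Y X) :=
      Rel.card_interedges_comm (r := H.Adj) X Y
    rw [h2, mul_comm (#X : ℝ)]
    exact h1⟩⟩
  loopless := ⟨fun i h => h.1 rfl⟩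

theorem linkedAlong_linkGraph {V ι : Type*} (H : SimpleGraph V) [DecidableRel H.Adj]
    (C : ι → Finset V) {β : ℕ} (hβ : 1 ≤ β) (κ : ℝ) :
    LinkedAlong H (linkGraph H C β κ) C β κ := by
  intro i j hij X hX Y hY hXβ hYβ
  have h := hij.2 X hX Y hY hXβ hYβ
  by_contra! hcon
  have hne : X.Nonempty := card_pos.1 (by omega)
  have hsum : #(H.interedges X Y) = ∑ x ∈ X, #{y ∈ Y | H.Adj x y} := by
    rw [SimpleGraph.interedges_def, card_filter, sum_product]
    simp only [card_filter]
  have hlt : ∑ x ∈ X, (#{y ∈ Y | H.Adj x y} : ℝ) < ∑ x ∈ X, κ * #Y :=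
    sum_lt_sum_of_nonempty hne hcon
  rw [sum_const, nsmul_eq_mul] at hlt
  rw [hsum] at h
  push_cast at h
  linarith

theorem linkGraph_adj_or_of_isUniform {V ι : Type*} [DecidableEq V] {G H₀ H₁ : SimpleGraph V}
    [DecidableRel G.Adj] [DecidableRel H₀.Adj] [DecidableRel H₁.Adj] (hG : G ≤ H₀ ⊔ H₁)
    {s c ε : ℝ} (hd : LowerDense G s c) (hε : ε ≤ c / 4) {C : ι → Finset V} {β : ℕ}
    (hβ : 1 ≤ β) (hsβ : s ≤ β) {i j : ι} (hij : i ≠ j) (hC : Disjoint (C i) (C j))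
    (hi : #(C i) * ε ≤ β) (hj : #(C j) * ε ≤ β) (hU : H₀.IsUniform ε (C i) (C j)) :
    (linkGraph H₀ C β (c / 4)).Adj i j ∨ (linkGraph H₁ C β (c / 4)).Adj i j := by
  have key : ∀ X ⊆ C i, ∀ Y ⊆ C j, β ≤ #X → β ≤ #Y → 0 < (#X * #Y : ℝ) ∧
      |(#(H₀.interedges X Y) : ℝ) / (#X * #Y) - (H₀.edgeDensity (C i) (C j) : ℝ)| < ε := by
    intro X hX Y hY hXβ hYβ
    have hXβ' : (β : ℝ) ≤ #X := by exact_mod_cast hXβ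
    have hYβ' : (β : ℝ) ≤ #Y := by exact_mod_cast hYβ
    have hβ' : (1 : ℝ) ≤ β := by exact_mod_cast hβ
    refine ⟨mul_pos (by linarith) (by linarith), ?_⟩
    have := hU hX hY (hi.trans hXβ') (hj.trans hYβ')
    rw [SimpleGraph.edgeDensity_def] at this
    push_cast at this
    exact this
  by_cases hden : c / 2 ≤ H₀.edgeDensity (C i) (C j)
  · refine .inl ⟨hij, fun X hX Y hY hXβ hYβ => ?_⟩
    obtain ⟨hpos, habs⟩ := key X hX Y hY hXβ hYβ
    rw [← le_div_iff₀ hpos]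
    have := (abs_lt.1 habs).1
    linarith
  · refine .inr ⟨hij, fun X hX Y hY hXβ hYβ => ?_⟩
    obtain ⟨hpos, habs⟩ := key X hX Y hY hXβ hYβ
    have h0 : (#(H₀.interedges X Y) : ℝ) / (#X * #Y) ≤ 3 * c / 4 := by
      have := (abs_lt.1 habs).2
      push Not at hden
      linarith
    rw [div_le_iff₀ hpos] at h0
    have hXβ' : (β : ℝ) ≤ #X := by exact_mod_cast hXβ
    have hYβ' : (β : ℝ) ≤ #Y := by exact_mod_cast hYβ
    have h1 := hd X Y (disjoint_of_subset_left hX (disjoint_of_subset_right hY hC))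
      (hsβ.trans hXβ') (hsβ.trans hYβ')
    have hsub : G.interedges X Y ⊆ H₀.interedges X Y ∪ H₁.interedges X Y := by
      intro e he
      simp only [mem_union, SimpleGraph.mem_interedges_iff] at he ⊢
      rcases hG he.2.2 with h | h
      exacts [.inl ⟨he.1, he.2.1, h⟩, .inr ⟨he.1, he.2.1, h⟩]
    have h2 : (#(G.interedges X Y) : ℝ) ≤ #(H₀.interedges X Y) + #(H₁.interedges X Y) := by
      exact_mod_cast (card_le_card hsub).trans (card_union_le _ _)
    linarith

open Classical in
/-- A relation with few pairs has few elements related to many others. -/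
theorem exists_large_set_few_related {ι : Type*} [Fintype ι] (r : ι → ι → Prop) {θ : ℝ}
    (hθ : 0 < θ)
    (h : (#{x : ι × ι | r x.1 x.2} : ℝ) ≤ θ ^ 2 * (Fintype.card ι : ℝ) ^ 2) :
    ∃ Z : Finset ι, (1 - θ) * Fintype.card ι ≤ #Z ∧
      ∀ v ∈ Z, (#{u | r v u} : ℝ) ≤ θ * Fintype.card ι := by
  refine ⟨univ.filter fun v => (#{u | r v u} : ℝ) ≤ θ * Fintype.card ι, ?_,
    fun v hv => (mem_filter.1 hv).2⟩
  rcases (Fintype.card ι).eq_zero_or_pos with h0 | hpos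
  · simp [h0]
  have hk : (0 : ℝ) < Fintype.card ι := by exact_mod_cast hpos
  have hsum : #{x : ι × ι | r x.1 x.2} = ∑ v : ι, #{u | r v u} := by
    simp only [card_filter]
    rw [← univ_product_univ, sum_product]
  set B : Finset ι := {v | ¬ (#{u | r v u} : ℝ) ≤ θ * Fintype.card ι}
  have hB : #B * (θ * Fintype.card ι) ≤ θ ^ 2 * (Fintype.card ι : ℝ) ^ 2 := by
    refine le_trans ?_ h
    rw [hsum, ← nsmul_eq_mul, ← sum_const]
    push_cast
    refine (sum_le_sum (g := fun v => (#{u | r v u} : ℝ)) fun v hv => ?_).trans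
      (sum_le_univ_sum_of_nonneg fun v => Nat.cast_nonneg _)
    exact (not_le.1 (mem_filter.1 hv).2).le
  have hB' : (#B : ℝ) ≤ θ * Fintype.card ι := by
    have : #B * (θ * Fintype.card ι) ≤ θ * Fintype.card ι * (θ * Fintype.card ι) := by
      linarith
    exact le_of_mul_le_mul_right this (by positivity)
  have htot := card_filter_add_card_filter_not (s := (univ : Finset ι))
    (fun v => (#{u | r v u} : ℝ) ≤ θ * Fintype.card ι)
  rw [card_univ] at htot
  have htot' : (#(univ.filter fun v => (#{u | r v u} : ℝ) ≤ θ * Fintype.card ι) : ℝ) + #B =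
      Fintype.card ι := by exact_mod_cast htot
  linarith

open Classical in
theorem card_filter_not_adj_le {ι : Type*} [Fintype ι] {R₀ R₁ : SimpleGraph ι} {r : ι → Prop}
    (Z : Finset ι) {u : ι} {b : ℝ} (h : ∀ v, u ≠ v → ¬ r v → R₀.Adj u v ∨ R₁.Adj u v)
    (hb : (#{v | r v} : ℝ) ≤ b) :
    (#{v ∈ Z | ¬ R₀.Adj u v ∧ ¬ R₁.Adj u v} : ℝ) ≤ b + 1 := by
  have hsub : {v ∈ Z | ¬ R₀.Adj u v ∧ ¬ R₁.Adj u v} ⊆ insert u ({v | r v} : Finset ι) := by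
    intro v hv
    simp only [mem_filter, mem_insert, mem_univ, true_and] at hv ⊢
    by_contra! hcon
    rcases h v hcon.1.symm hcon.2 with h | h
    exacts [hv.2.1 h, hv.2.2 h]
  have h1 := (card_le_card hsub).trans (card_insert_le _ _)
  have h2 : (#{v ∈ Z | ¬ R₀.Adj u v ∧ ¬ R₁.Adj u v} : ℝ) ≤ #{v | r v} + 1 := by
    exact_mod_cast h1
  linarith

open Classical in
/-- The regularity lemma for two graphs covering a graph without sparse pairs of large sets:
after deleting a few clusters, every cluster is linked to almost all others in one of them. -/
theorem exists_finpartition_linkGraph {V : Type*} [Fintype V] {G H₀ H₁ : SimpleGraph V}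
    (hG : G ≤ H₀ ⊔ H₁) {s c ε θ : ℝ} (hd : LowerDense G s c) (hε0 : 0 < ε) (hε : ε ≤ c / 4)
    (hθ : 0 < θ) (hεθ : ε ≤ θ ^ 2) {l : ℕ} (hl : l ≤ Fintype.card V) :
    ∃ P : Finpartition (univ : Finset V), P.IsEquipartition ∧ l ≤ #P.parts ∧
      #P.parts ≤ SzemerediRegularity.bound ε l ∧
      ∃ Z : Finset P.parts, (1 - θ) * #P.parts ≤ #Z ∧ ∀ β : ℕ, 1 ≤ β → s ≤ β →
        (∀ A ∈ P.parts, #A * ε ≤ β) → ∀ u ∈ Z,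
        (#{v ∈ Z | ¬ (linkGraph H₀ (fun A : P.parts => A.1) β (c / 4)).Adj u v ∧
          ¬ (linkGraph H₁ (fun A : P.parts => A.1) β (c / 4)).Adj u v} : ℝ) ≤
          θ * #P.parts + 1 := by
  obtain ⟨P, hP, hlP, hPb, hPU⟩ := szemeredi_regularity H₀ hε0 hl
  refine ⟨P, hP, hlP, hPb, ?_⟩
  obtain ⟨r, hr_iff⟩ : ∃ r : P.parts → P.parts → Prop,
      ∀ A B, r A B ↔ A ≠ B ∧ ¬ H₀.IsUniform ε A.1 B.1 := ⟨_, fun _ _ => Iff.rfl⟩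
  have hr : (#{x : P.parts × P.parts | r x.1 x.2} : ℝ) ≤
      θ ^ 2 * (Fintype.card P.parts : ℝ) ^ 2 := by
    have h1 : #{x : P.parts × P.parts | r x.1 x.2} ≤ #(P.nonUniforms H₀ ε) := by
      refine card_le_card_of_injOn (fun x => (x.1.1, x.2.1)) ?_ ?_
      · rintro ⟨A, B⟩ hAB
        have hAB := (hr_iff A B).1 (by simpa using hAB)
        have hne : A.1 ≠ B.1 := fun h => hAB.1 (Subtype.ext h)
        exact mem_coe.2 ((Finpartition.mk_mem_nonUniforms _ _).2 ⟨A.2, B.2, hne, hAB.2⟩)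
      · rintro ⟨A, B⟩ - ⟨A', B'⟩ - h
        rw [Prod.mk.injEq] at h
        exact Prod.ext (Subtype.ext h.1) (Subtype.ext h.2)
    have h2 : ((#P.parts * (#P.parts - 1) : ℕ) : ℝ) ≤ (#P.parts : ℝ) ^ 2 := by
      rw [sq]; exact_mod_cast Nat.mul_le_mul_left _ (Nat.sub_le _ _)
    have h1' : (#{x : P.parts × P.parts | r x.1 x.2} : ℝ) ≤ #(P.nonUniforms H₀ ε) := by
      exact_mod_cast h1
    rw [Fintype.card_coe]
    calc _ ≤ _ := h1'
      _ ≤ _ := hPU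
      _ ≤ (#P.parts : ℝ) ^ 2 * θ ^ 2 := by gcongr
      _ = _ := mul_comm _ _
  obtain ⟨Z, hZc, hZ⟩ := exists_large_set_few_related r hθ hr
  rw [Fintype.card_coe] at hZc hZ
  refine ⟨Z, hZc, fun β hβ hsβ hβP u hu => ?_⟩
  refine card_filter_not_adj_le Z (fun v hne hr' => ?_) (hZ u hu)
  have hU : H₀.IsUniform ε u.1 v.1 := by
    by_contra h
    exact hr' ((hr_iff _ _).2 ⟨hne, h⟩)
  exact linkGraph_adj_or_of_isUniform (C := fun A : P.parts => A.1) hG hd hε hβ hsβ hne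
    (P.disjoint u.2 v.2 fun h => hne (Subtype.ext h)) (hβP _ u.2) (hβP _ v.2) hU

end Regularity

section CycleOrCycle

open Finset

theorem exists_isCycle_or_of_clusters {V : Type*} [Fintype V] {G H₀ H₁ : SimpleGraph V}
    [DecidableRel G.Adj] [DecidableRel H₀.Adj] [DecidableRel H₁.Adj]
    (hG : G ≤ H₀ ⊔ H₁) {s c ε θ : ℝ} (hd : LowerDense G s c) (hε0 : 0 < ε) (hε : ε ≤ c / 4)
    (hθ : 0 < θ) (hεθ : ε ≤ θ ^ 2) {l a b : ℕ} (hl : l ≤ Fintype.card V)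
    (h : ∀ k, l ≤ k → k ≤ SzemerediRegularity.bound ε l → ∃ β T x y t : ℕ, 1 ≤ β ∧ s ≤ β ∧
      ((Fintype.card V / k : ℕ) + 1) * ε ≤ β ∧ 2 * (β : ℝ) ≤ c / 4 * T ∧ β ≤ T ∧
      1 ≤ y ∧ y ≤ x ∧ 2 * x + y + 6 * (θ * k + 1) + 3 ≤ (1 - θ) * k ∧
      k * k + 2 ≤ a ∧ k * k + 2 ≤ b ∧ a ≤ x * t ∧ b ≤ y * t ∧
      t + 3 * k + 3 + β + T ≤ Fintype.card V / k) :
    (∃ (v : V) (w : H₀.Walk v v), w.IsCycle ∧ w.length = 2 * a) ∨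
      ∃ (v : V) (w : H₁.Walk v v), w.IsCycle ∧ w.length = 2 * b := by
  classical
  obtain ⟨P, hP, hlP, hPK, Z, hZc, hZ⟩ := exists_finpartition_linkGraph hG
    (by convert hd) hε0 hε hθ hεθ hl
  obtain ⟨β, T, x, y, t, hβ, hsβ, hmβ, hβT, hβT', hy, hyx, hxy, hka, hkb, hax, hby, ht⟩ :=
    h _ hlP hPK
  set C : P.parts → Finset V := fun A => A.1 with hC
  have hm : ∀ A : P.parts, Fintype.card V / #P.parts ≤ #(C A) := fun A =>
    hP.average_le_card_part A.2
  have hdisj : ∀ A B : P.parts, A ≠ B → Disjoint (C A) (C B) := fun A B hAB =>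
    P.disjoint A.2 B.2 fun h => hAB (Subtype.ext h)
  have hZ' := hZ β hβ hsβ fun A hA => by
    have h1 : #A ≤ Fintype.card V / #P.parts + 1 := hP.card_part_le_average_add_one hA
    have h2 : (#A : ℝ) ≤ (Fintype.card V / #P.parts : ℕ) + 1 := by exact_mod_cast h1
    exact (mul_le_mul_of_nonneg_right h2 hε0.le).trans hmβ
  have he : (⌊θ * #P.parts + 1⌋₊ : ℝ) ≤ θ * #P.parts + 1 := Nat.floor_le (by positivity)
  have hxy' : 2 * x + y + 6 * ⌊θ * #P.parts + 1⌋₊ + 3 ≤ #Z := by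
    have : (2 * x + y + 6 * ⌊θ * #P.parts + 1⌋₊ + 3 : ℝ) ≤ #Z := by linarith
    exact_mod_cast this
  have hxk : x ≤ #P.parts := by
    have : #Z ≤ #P.parts := by simpa using card_le_univ Z
    omega
  have hcard : Fintype.card P.parts = #P.parts := Fintype.card_coe _
  have hβ' : (1 : ℝ) ≤ β := by exact_mod_cast hβ
  rcases hasConnMatching_or (linkGraph H₀ C β (c / 4)) (linkGraph H₁ C β (c / 4)) Z
    ⌊θ * #P.parts + 1⌋₊ x y
    (fun u hu => Nat.le_floor ((le_of_eq (by congr!)).trans (hZ' u hu))) hxy' hyx with hM | hM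
  · refine .inl ((linkedAlong_linkGraph H₀ C hβ (c / 4)).exists_isCycle hdisj (hε0.trans_le hε) hβ
      hβT hβT' (hy.trans hyx) hM hm ?_ hax (by omega))
    rw [hcard]
    exact (Nat.add_le_add_right (Nat.mul_le_mul_left _ hxk) 2).trans hka
  · refine .inr ((linkedAlong_linkGraph H₁ C hβ (c / 4)).exists_isCycle hdisj (hε0.trans_le hε) hβ
      hβT hβT' hy hM hm ?_ hby (by omega))
    rw [hcard]
    exact (Nat.add_le_add_right (Nat.mul_le_mul_left _ (hyx.trans hxk)) 2).trans hkb

theorem floor_mul_le_mul {α ξ σ δ τ n k m : ℝ} {x t : ℕ} (hξ0 : 0 ≤ ξ) (hξ1 : ξ ≤ 1)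
    (hξ : ξ * σ = α + δ / 6) (hx : ξ * k ≤ x) (ht : (1 - τ) * m ≤ t) (hτ0 : 0 ≤ τ) (hτ1 : τ ≤ 1)
    (hτ : τ * σ = δ / 12) (hσ : 0 ≤ σ) (hn : 0 ≤ n) (hk : 0 ≤ k) (hkm : σ * n - k ≤ k * m)
    (hkn : 12 * k ≤ δ * n) : ⌊α * n⌋₊ ≤ x * t := by
  have h1 : ξ * (1 - τ) * (σ * n - k) ≤ ξ * (1 - τ) * (k * m) :=
    mul_le_mul_of_nonneg_left hkm (mul_nonneg hξ0 (by linarith))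
  have h2 : ξ * k * ((1 - τ) * m) ≤ x * t :=
    (mul_le_mul_of_nonneg_left ht (by positivity)).trans
      (mul_le_mul_of_nonneg_right hx (Nat.cast_nonneg t))
  have h3 : ξ * τ * σ * n ≤ δ / 12 * n := by
    rw [← hτ]
    have := mul_le_mul_of_nonneg_right hξ1 (by positivity : 0 ≤ τ * σ * n)
    linarith
  have h4 : ξ * (1 - τ) * k ≤ k := by
    have : ξ * (1 - τ) ≤ 1 := mul_le_one₀ hξ1 (by linarith) (by linarith)
    have := mul_le_mul_of_nonneg_right this hk
    linarith
  have h5 : ξ * σ * n = (α + δ / 6) * n := by rw [hξ]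
  have h6 : α * n ≤ (x * t : ℕ) := by
    push_cast
    linarith
  exact Nat.floor_le_of_le h6

theorem exists_isCycle_or_of_lowerDense {α₁ α₂ δ c : ℝ} (h12 : α₂ ≤ α₁) (h2 : 0 < α₂)
    (hδ : 0 < δ) (hc0 : 0 < c) (hc1 : c ≤ 1) :
    ∃ γ : ℝ, 0 < γ ∧ ∀ᶠ n : ℕ in Filter.atTop,
      ∀ (V : Type) [Fintype V] (G H₀ H₁ : SimpleGraph V) [DecidableRel G.Adj],
      Fintype.card V = ⌈(2 * α₁ + α₂ + δ) * (n : ℝ)⌉₊ → G ≤ H₀ ⊔ H₁ →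
      LowerDense G (γ * Fintype.card V) c →
      (∃ (v : V) (w : H₀.Walk v v), w.IsCycle ∧ w.length = 2 * ⌊α₁ * (n : ℝ)⌋₊) ∨
      ∃ (v : V) (w : H₁.Walk v v), w.IsCycle ∧ w.length = 2 * ⌊α₂ * (n : ℝ)⌋₊ := by
  obtain ⟨σ, hσ⟩ : ∃ σ, σ = 2 * α₁ + α₂ + δ := ⟨_, rfl⟩
  have hσ0 : 0 < σ := by linarith
  obtain ⟨θ, hθ⟩ : ∃ θ, θ * σ = δ / 22 := ⟨δ / 22 / σ, div_mul_cancel₀ _ hσ0.ne'⟩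
  obtain ⟨τ, hτ⟩ : ∃ τ, τ * σ = δ / 12 := ⟨δ / 12 / σ, div_mul_cancel₀ _ hσ0.ne'⟩
  obtain ⟨ξ, hξ⟩ : ∃ ξ, ξ * σ = α₁ + δ / 6 := ⟨_, div_mul_cancel₀ _ hσ0.ne'⟩
  obtain ⟨η, hη⟩ : ∃ η, η * σ = α₂ + δ / 6 := ⟨_, div_mul_cancel₀ _ hσ0.ne'⟩
  have hθ0 : 0 < θ := pos_of_mul_pos_left (by rw [hθ]; positivity) hσ0.le
  have hτ0 : 0 < τ := pos_of_mul_pos_left (by rw [hτ]; positivity) hσ0.le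
  have hη0 : 0 < η := pos_of_mul_pos_left (by rw [hη]; positivity) hσ0.le
  have hηξ : η ≤ ξ := le_of_mul_le_mul_right (by rw [hξ, hη]; linarith) hσ0
  have hξ0 : 0 < ξ := hη0.trans_le hηξ
  have hsum : 2 * ξ + η = 1 - 11 * θ :=
    mul_right_cancel₀ hσ0.ne' (by linear_combination 2 * hξ + hη + 11 * hθ - hσ)
  have hτ1 : τ ≤ 1 := le_of_mul_le_mul_right (by rw [hτ]; linarith) hσ0
  obtain ⟨κ, hκ⟩ : ∃ κ, κ = c / 4 := ⟨_, rfl⟩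
  have hκ0 : 0 < κ := by linarith
  obtain ⟨ε, hε0, hεθ, hεκ, hετ⟩ : ∃ ε : ℝ, 0 < ε ∧ ε ≤ θ ^ 2 ∧ ε ≤ κ ∧ ε ≤ κ * τ / 6 :=
    ⟨min (θ ^ 2) (min κ (κ * τ / 6)), by positivity, min_le_left _ _,
      (min_le_right _ _).trans (min_le_left _ _), (min_le_right _ _).trans (min_le_right _ _)⟩
  obtain ⟨l, hl⟩ : ∃ l : ℕ, l = ⌈3 / θ⌉₊ := ⟨_, rfl⟩
  obtain ⟨K, hK⟩ : ∃ K, K = SzemerediRegularity.bound ε l := ⟨_, rfl⟩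
  have hK0 : 0 < K := by rw [hK]; exact SzemerediRegularity.bound_pos _ _
  have hK0' : (0 : ℝ) < K := by exact_mod_cast hK0
  have hl0 : 0 < l := by rw [hl]; exact Nat.ceil_pos.2 (by positivity)
  refine ⟨ε / K, by positivity, ?_⟩
  have ev (r A : ℝ) (hr : 0 < r) : ∀ᶠ n : ℕ in Filter.atTop, A ≤ r * n :=
    (tendsto_natCast_atTop_atTop.const_mul_atTop hr).eventually_ge_atTop A
  filter_upwards [ev σ l hσ0, ev δ (12 * K) hδ, ev α₂ (K * K + 3) h2,
    ev σ (K * (2 / τ * (3 * K + 4 + 6 / κ) + 1)) hσ0] with n hn1 hn2 hn3 hn4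
  intro V _ G H₀ H₁ _ hV hG hd
  classical
  rw [← hσ] at hV
  have hσV : σ * n ≤ Fintype.card V := by rw [hV]; exact Nat.le_ceil _
  refine exists_isCycle_or_of_clusters hG hd hε0 (hκ ▸ hεκ) hθ0 hεθ (l := l) ?_ ?_
  · exact_mod_cast hn1.trans hσV
  intro k hlk hkK
  rw [← hK] at hkK
  have hkK' : (k : ℝ) ≤ K := by exact_mod_cast hkK
  have hk0 : 0 < k := hl0.trans_le hlk
  have hk0' : (0 : ℝ) < k := by exact_mod_cast hk0
  have hθk : 3 ≤ θ * k := by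
    have h1 : 3 / θ ≤ k := (Nat.le_ceil _).trans (by rw [← hl]; exact_mod_cast hlk)
    rwa [div_le_iff₀' hθ0] at h1
  obtain ⟨m, hm⟩ : ∃ m, m = Fintype.card V / k := ⟨_, rfl⟩
  have hmV : (Fintype.card V : ℝ) ≤ k * (m + 1) := by
    have : Fintype.card V < k * (m + 1) := by rw [hm]; exact Nat.lt_mul_div_succ _ hk0
    exact_mod_cast this.le
  have hm1 : 3 * K + 4 + 6 / κ ≤ τ / 2 * m := by
    have h1 : K * (2 / τ * (3 * K + 4 + 6 / κ) + 1) ≤ K * ((m : ℝ) + 1) :=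
      hn4.trans (hσV.trans (hmV.trans (by gcongr)))
    have h2 : 2 / τ * (3 * K + 4 + 6 / κ) ≤ m := by
      have := le_of_mul_le_mul_left h1 hK0'
      linarith
    calc _ = τ / 2 * (2 / τ * (3 * K + 4 + 6 / κ)) := by field_simp
      _ ≤ _ := by gcongr
  obtain ⟨β, hβ⟩ : ∃ β, β = ⌈(m + 1) * ε⌉₊ := ⟨_, rfl⟩
  obtain ⟨T, hT⟩ : ∃ T, T = ⌈2 * β / κ⌉₊ := ⟨_, rfl⟩
  have hβ1 : (m + 1) * ε ≤ β := by rw [hβ]; exact Nat.le_ceil _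
  have hβ2 : β ≤ (m + 1) * ε + 1 := by rw [hβ]; exact (Nat.ceil_lt_add_one (by positivity)).le
  have hT1 : 2 * β / κ ≤ T := by rw [hT]; exact Nat.le_ceil _
  have hT2 : T ≤ 2 * β / κ + 1 := by rw [hT]; exact (Nat.ceil_lt_add_one (by positivity)).le
  have hβκ : β ≤ β / κ := le_div_self (Nat.cast_nonneg β) hκ0 (by linarith)
  have hβT : β + T ≤ τ / 2 * m + 6 / κ + 1 := by
    have h1 : (β : ℝ) / κ ≤ ((m + 1) * ε + 1) / κ := by gcongr
    have h3 : (m * ε) / κ ≤ τ / 6 * m := by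
      rw [div_le_iff₀ hκ0]
      have := mul_le_mul_of_nonneg_left hετ (Nat.cast_nonneg (α := ℝ) m)
      linarith
    have h4 : (ε + 1) / κ ≤ 2 / κ := by gcongr; linarith
    have h5 : ((m + 1) * ε + 1) / κ = m * ε / κ + (ε + 1) / κ := by ring
    have h6 : 2 * (β : ℝ) / κ = 2 * (β / κ) := by ring
    have h7 : 6 / κ = 3 * (2 / κ) := by ring
    linarith
  have hmt : 3 * k + 3 + β + T ≤ m := by
    have h1 : τ * m ≤ m := mul_le_of_le_one_left (Nat.cast_nonneg m) hτ1
    have : (3 * k + 3 + β + T : ℝ) ≤ m := by linarith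
    exact_mod_cast this
  obtain ⟨t, ht⟩ := Nat.exists_eq_add_of_le hmt
  have ht' : (1 - τ) * m ≤ t := by
    have h1 : (m : ℝ) = 3 * k + 3 + β + T + t := by exact_mod_cast ht
    linarith
  have hkk : (k * k : ℝ) ≤ K * K := by gcongr
  have hfl : ∀ α, α₂ ≤ α → k * k + 2 ≤ ⌊α * n⌋₊ := by
    intro α hα
    apply Nat.le_floor
    have := mul_le_mul_of_nonneg_right hα (Nat.cast_nonneg (α := ℝ) n)
    push_cast
    linarith
  have hβpos : 0 < β := by rw [hβ]; exact Nat.ceil_pos.2 (by positivity)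
  refine ⟨β, T, ⌈ξ * k⌉₊, ⌈η * k⌉₊, t, hβpos, ?_, by rwa [← hm], ?_, ?_,
    Nat.ceil_pos.2 (by positivity), Nat.ceil_mono (by gcongr), ?_, hfl _ h12, hfl _ le_rfl, ?_, ?_,
    by omega⟩
  · refine le_trans ?_ hβ1
    rw [div_mul_eq_mul_div, div_le_iff₀ hK0']
    have h1 : (Fintype.card V : ℝ) ≤ K * (m + 1) := hmV.trans (by gcongr)
    have := mul_le_mul_of_nonneg_left h1 hε0.le
    linarith
  · rwa [← hκ, ← div_le_iff₀' hκ0]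
  · have h1 : (β : ℝ) ≤ T := by
      have : 2 * (β : ℝ) / κ = 2 * (β / κ) := by ring
      have := Nat.cast_nonneg (α := ℝ) β
      linarith
    exact_mod_cast h1
  · have h3 := (Nat.ceil_lt_add_one (by positivity : 0 ≤ ξ * k)).le
    have h4 := (Nat.ceil_lt_add_one (by positivity : 0 ≤ η * k)).le
    have h5 : (2 * ξ + η) * k = (1 - 11 * θ) * k := by rw [hsum]
    linarith
  · exact floor_mul_le_mul hξ0.le (by linarith) hξ (Nat.le_ceil _) ht' hτ0.le hτ1 hτ hσ0.le
      (Nat.cast_nonneg n) hk0'.le (by linarith) (by linarith)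
  · exact floor_mul_le_mul hη0.le (by linarith) hη (Nat.le_ceil _) ht' hτ0.le hτ1 hτ hσ0.le
      (Nat.cast_nonneg n) hk0'.le (by linarith) (by linarith)

end CycleOrCycle

section ColorGraph

/-- The graph formed by the edges of color `i`. -/
def colorGraph {V : Type*} (F : SimpleGraph V) {k : ℕ} (c : F.edgeSet → Fin k) (i : Fin k) :
    SimpleGraph V :=
  SimpleGraph.fromEdgeSet {e | ∃ h : e ∈ F.edgeSet, c ⟨e, h⟩ = i}

theorem colorGraph_le {V : Type*} (F : SimpleGraph V) {k : ℕ} (c : F.edgeSet → Fin k)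
    (i : Fin k) : colorGraph F c i ≤ F := by
  intro u v h
  obtain ⟨⟨h, -⟩, -⟩ := (SimpleGraph.fromEdgeSet_adj _).1 h
  exact h

theorem le_colorGraph_sup {V : Type*} (F : SimpleGraph V) (c : F.edgeSet → Fin 2) :
    F ≤ colorGraph F c 0 ⊔ colorGraph F c 1 := by
  intro u v h
  rcases Fin.exists_fin_two.1 ⟨c ⟨s(u, v), h⟩, rfl⟩ with hc | hc
  · exact .inl ((SimpleGraph.fromEdgeSet_adj _).2 ⟨⟨h, hc⟩, h.ne⟩)
  · exact .inr ((SimpleGraph.fromEdgeSet_adj _).2 ⟨⟨h, hc⟩, h.ne⟩)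

theorem hasMonoCycle_of_isCycle {V : Type*} (F : SimpleGraph V) {k : ℕ} (c : F.edgeSet → Fin k)
    (i : Fin k) {m : ℕ}
    (h : ∃ (v : V) (w : (colorGraph F c i).Walk v v), w.IsCycle ∧ w.length = m) :
    HasMonoCycle F c i m := by
  obtain ⟨v, w, hw, hm⟩ := h
  refine ⟨v, w.mapLe (colorGraph_le F c i), hw.mapLe _, by simpa using hm, fun e he => ?_⟩
  rw [SimpleGraph.Walk.edges_mapLe_eq_edges] at he
  have h := w.edges_subset_edgeSet he
  rw [colorGraph, SimpleGraph.edgeSet_fromEdgeSet] at h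
  obtain ⟨⟨_, h⟩, -⟩ := h
  exact h

end ColorGraph

theorem stmt5 (p : ℝ) (hp0 : 0 < p) (hp1 : p ≤ 1) (α₁ α₂ : ℝ)
    (h12 : α₂ ≤ α₁) (h2 : 0 < α₂) (δ : ℝ) (hδ : 0 < δ) :
    Filter.Tendsto (fun n : ℕ =>
        graphProbability (⌈(2 * α₁ + α₂ + δ) * (n : ℝ)⌉₊) p
          {G | ArrowsCycles G ![2 * ⌊α₁ * (n : ℝ)⌋₊, 2 * ⌊α₂ * (n : ℝ)⌋₊]})
      Filter.atTop (nhds 1) := by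
  obtain ⟨γ, hγ, hev⟩ := exists_isCycle_or_of_lowerDense (c := p / 4) h12 h2 hδ (by linarith)
    (by linarith)
  have hσ : 0 < 2 * α₁ + α₂ + δ := by linarith
  have hN : Filter.Tendsto (fun n : ℕ => ⌈(2 * α₁ + α₂ + δ) * (n : ℝ)⌉₊) Filter.atTop
      Filter.atTop :=
    tendsto_nat_ceil_atTop.comp (tendsto_natCast_atTop_atTop.const_mul_atTop hσ)
  refine tendsto_of_tendsto_of_tendsto_of_le_of_le'
    ((tendsto_graphProbability_lowerDense hp0 hp1 hγ).comp hN) tendsto_const_nhds ?_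
    (.of_forall fun n => (graphProbability_mono hp0.le hp1 (Set.subset_univ _)).trans
      (graphProbability_univ _ _).le)
  filter_upwards [hev] with n hn
  refine graphProbability_mono hp0.le hp1 fun G hG c => ?_
  classical
  rcases hn _ G (colorGraph G c 0) (colorGraph G c 1) (Fintype.card_fin _)
    (le_colorGraph_sup G c) (by rw [Fintype.card_fin]; exact hG) with h | h
  · exact ⟨0, hasMonoCycle_of_isCycle G c 0 h⟩
  · exact ⟨1, hasMonoCycle_of_isCycle G c 1 h⟩
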